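/- There exists an absolute constant c > 0 such that for every r > 0 and every vector field v ∈ C¹ on the closure of Q⁺(r) satisfying the Dirichlet condition v(x',0,t) = 0 for all |x'| < r and −r² < t < 0, one has the multiplicative inequality C(v,r) ≤ c · A(v,r)^{3/4} · E(v,r)^{3/4}. -/

import Mathlib

open MeasureTheory Real Set

noncomputable section

abbrev E3 := EuclideanSpace ℝ (Fin 3)

/-- The half ball `B⁺(r) = {x ∈ ℝ³ : |x| < r, x₃ > 0}`. -/
def halfBall (r : ℝ) : Set E3 := {x | ‖x‖ < r ∧ 0 < x 2}

/-- The parabolic half-cylinder `Q⁺(r) = B⁺(r) × (−r², 0)`. -/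
def halfCyl (r : ℝ) : Set (E3 × ℝ) := (halfBall r) ×ˢ (Ioo (-r^2) 0)

/-- `A(v,r) = sup_{−r²<t<0} (1/r) ∫_{B⁺(r)} |v(x,t)|² dx`. -/
def qtyA (v : E3 → ℝ → E3) (r : ℝ) : ℝ :=
  ⨆ t : Ioo (-r^2) (0:ℝ), (1/r) * ∫ x in halfBall r, ‖v x (t:ℝ)‖^2

/-- `E(v,r) = (1/r) ∫_{Q⁺(r)} |∇v|² dz`. -/
def qtyE (v : E3 → ℝ → E3) (r : ℝ) : ℝ :=
  (1/r) * ∫ t in Ioo (-r^2) (0:ℝ), ∫ x in halfBall r, ‖fderiv ℝ (fun y => v y t) x‖^2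

/-- `C(v,r) = (1/r²) ∫_{Q⁺(r)} |v|³ dz`. -/
def qtyC (v : E3 → ℝ → E3) (r : ℝ) : ℝ :=
  (1/r^2) * ∫ t in Ioo (-r^2) (0:ℝ), ∫ x in halfBall r, ‖v x t‖^3

/-- If `u` vanishes at the end of a segment, then `|u|²` at its start is controlled by the integral
of `|u| |∇u|` along the segment. -/
lemma enorm_sq_le_setLIntegral_segment {u : E3 → E3} {x d : E3} {b : ℝ} (hb : 0 ≤ b)
    (hcont : ContinuousOn (fun τ : ℝ => u (x + τ • d)) (Icc 0 b))
    (hdiff : ∀ τ ∈ Ioo 0 b, DifferentiableAt ℝ u (x + τ • d))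
    (hzero : u (x + b • d) = 0) (hd : ‖d‖ ≤ 2) :
    ‖u x‖ₑ ^ 2 ≤
      ∫⁻ τ in Ioo 0 b, 4 * (‖u (x + τ • d)‖ₑ * ‖fderiv ℝ u (x + τ • d)‖ₑ) := by
  set g : ℝ → ℝ := fun τ => ‖u (x + τ • d)‖ ^ 2 with hg
  have hderiv : ∀ τ ∈ Ioo 0 b,
      HasDerivAt g (2 * inner ℝ (u (x + τ • d)) (fderiv ℝ u (x + τ • d) d)) τ := by
    intro τ hτ
    have h1 : HasDerivAt (fun τ : ℝ => x + τ • d) d τ := by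
      simpa using ((hasDerivAt_id τ).smul_const d).const_add x
    exact ((hdiff τ hτ).hasFDerivAt.comp_hasDerivAt τ h1).norm_sq
  have hbound : ∫⁻ τ in Ioo 0 b, ‖deriv g τ‖ₑ ≤
      ∫⁻ τ in Ioo 0 b, 4 * (‖u (x + τ • d)‖ₑ * ‖fderiv ℝ u (x + τ • d)‖ₑ) := by
    refine setLIntegral_mono' measurableSet_Ioo fun τ hτ => ?_
    rw [(hderiv τ hτ).deriv]
    have h : ‖2 * inner ℝ (u (x + τ • d)) (fderiv ℝ u (x + τ • d) d)‖ ≤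
        4 * (‖u (x + τ • d)‖ * ‖fderiv ℝ u (x + τ • d)‖) := by
      rw [norm_mul, Real.norm_two]
      have h1 := norm_inner_le_norm (𝕜 := ℝ) (u (x + τ • d)) (fderiv ℝ u (x + τ • d) d)
      have h2 : ‖fderiv ℝ u (x + τ • d) d‖ ≤ ‖fderiv ℝ u (x + τ • d)‖ * 2 :=
        (ContinuousLinearMap.le_opNorm _ _).trans (by gcongr)
      have h3 := mul_le_mul_of_nonneg_left h2 (norm_nonneg (u (x + τ • d)))
      linarith
    rw [← ofReal_norm]
    refine (ENNReal.ofReal_le_ofReal h).trans_eq ?_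
    rw [ENNReal.ofReal_mul (by norm_num), ENNReal.ofReal_mul (norm_nonneg _), ofReal_norm,
      ofReal_norm, ENNReal.ofReal_ofNat]
  refine le_trans ?_ hbound
  by_cases hint : IntegrableOn (deriv g) (Ioo 0 b)
  · have hii : IntervalIntegrable (deriv g) volume 0 b :=
      (intervalIntegrable_iff_integrableOn_Ioo_of_le hb).2 hint
    have hftc := intervalIntegral.integral_eq_sub_of_hasDerivAt_of_le hb (hcont.norm.pow 2)
      (fun τ hτ => (hderiv τ hτ).differentiableAt.hasDerivAt) hii
    rw [intervalIntegral.integral_of_le hb, integral_Ioc_eq_integral_Ioo] at hftc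
    calc ‖u x‖ₑ ^ 2 = ‖∫ τ in Ioo 0 b, deriv g τ‖ₑ := by
          rw [hftc]; simp [hzero]
      _ ≤ _ := enorm_integral_le_lintegral_enorm _
  · have : ∫⁻ τ in Ioo 0 b, ‖deriv g τ‖ₑ = ⊤ := by
      by_contra h
      exact hint ⟨(measurable_deriv g).aestronglyMeasurable, lt_top_iff_ne_top.2 h⟩
    rw [this]; exact le_top

/-- The matrix whose columns are the descending directions `(-a, 0, -1)`, `(0, -b, -1)` and
`(0, 0, -1)`. -/
def descentMatrix (a b : ℝ) : Matrix (Fin 3) (Fin 3) ℝ :=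
  !![-a, 0, 0; 0, -b, 0; -1, -1, -1]

/-- The linear coordinates on `ℝ³` along the columns of `descentMatrix a b`. -/
def descentMap (a b : ℝ) (y : Fin 3 → ℝ) : E3 :=
  WithLp.toLp 2 ((descentMatrix a b).toLin' y)

/-- The `i`-th column of `descentMatrix a b`. -/
def descentDir (a b : ℝ) (i : Fin 3) : E3 :=
  WithLp.toLp 2 fun j => descentMatrix a b j i

lemma descentMap_update (a b : ℝ) (y : Fin 3 → ℝ) (i : Fin 3) (s : ℝ) :
    descentMap a b (Function.update y i s) =
      descentMap a b y + (s - y i) • descentDir a b i := by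
  ext j
  fin_cases i <;> fin_cases j <;>
    simp [descentMap, descentDir, descentMatrix, dotProduct, Fin.sum_univ_three] <;>
    ring

lemma measurePreserving_descentMap {a b : ℝ} (ha : a ^ 2 = 1) (hb : b ^ 2 = 1) :
    MeasurePreserving (descentMap a b) := by
  have hdet : (descentMatrix a b).det = -(a * b) := by
    simp [descentMatrix, Matrix.det_fin_three]
  have habs : |(descentMatrix a b).det| = 1 := by
    rw [hdet, abs_neg, ← abs_one, ← sq_eq_sq_iff_abs_eq_abs, mul_pow, ha, hb]; norm_num
  have hne : (descentMatrix a b).det ≠ 0 := by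
    intro h; rw [h] at habs; simp at habs
  refine (PiLp.volume_preserving_toLp (Fin 3)).comp
    (g := WithLp.toLp 2) (f := (descentMatrix a b).toLin')
    ⟨(LinearMap.continuous_of_finiteDimensional _).measurable, ?_⟩
  rw [Real.map_matrix_volume_pi_eq_smul_volume_pi hne, abs_inv, habs]
  simp

lemma isOpen_halfBall (r : ℝ) : IsOpen (halfBall r) :=
  (isOpen_lt continuous_norm continuous_const).inter
    (isOpen_lt continuous_const (EuclideanSpace.proj (𝕜 := ℝ) (2 : Fin 3)).continuous)

lemma convex_halfBall (r : ℝ) : Convex ℝ (halfBall r) := by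
  have h : halfBall r = Metric.ball 0 r ∩ {x : E3 | 0 < x 2} := by
    ext x; simp [halfBall]
  rw [h]
  refine (convex_ball _ _).inter ?_
  exact convex_halfSpace_gt (EuclideanSpace.proj (𝕜 := ℝ) (2 : Fin 3)).isLinear 0

lemma norm_descentDir_le {a b : ℝ} (ha : a ^ 2 = 1) (hb : b ^ 2 = 1) (i : Fin 3) :
    ‖descentDir a b i‖ ≤ 2 := by
  refine le_of_sq_le_sq ?_ zero_le_two
  rw [EuclideanSpace.norm_sq_eq, Fin.sum_univ_three]
  fin_cases i <;> simp [descentDir, descentMatrix] <;> linarith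

lemma descentDir_two (a b : ℝ) (i : Fin 3) : descentDir a b i 2 = -1 := by
  fin_cases i <;> simp [descentDir, descentMatrix]

/-- Moving along a descending direction pointing towards the vertical axis does not leave the
ball before the flat boundary is reached. -/
lemma norm_add_smul_descentDir_le {a b : ℝ} (ha : a ^ 2 = 1) (hb : b ^ 2 = 1) (i : Fin 3) {x : E3}
    (hx0 : 0 ≤ a * x 0) (hx1 : 0 ≤ b * x 1) {s : ℝ} (hs : s ∈ Icc 0 (x 2)) :
    ‖x + s • descentDir a b i‖ ≤ ‖x‖ := by
  refine le_of_sq_le_sq ?_ (norm_nonneg _)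
  obtain ⟨h0, h1⟩ := hs
  have e0 := mul_nonneg h0 hx0
  have e1 := mul_nonneg h0 hx1
  have e2 := mul_nonneg h0 (sub_nonneg.2 h1)
  have e3 : s ^ 2 * a ^ 2 = s ^ 2 := by rw [ha, mul_one]
  have e4 : s ^ 2 * b ^ 2 = s ^ 2 := by rw [hb, mul_one]
  simp only [EuclideanSpace.norm_sq_eq, Fin.sum_univ_three, Real.norm_eq_abs, sq_abs]
  fin_cases i <;> simp [descentDir, descentMatrix] <;> nlinarith

lemma ContinuousOn.measurable_indicator_ennreal {s : Set E3} {f : E3 → ENNReal}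
    (hf : ContinuousOn f s) (hs : MeasurableSet s) : Measurable (s.indicator f) := by
  classical
  rw [← Set.piecewise_eq_indicator]
  exact hf.measurable_piecewise continuousOn_const hs

/-- A function on the half ball which vanishes on the flat boundary satisfies the estimate
`∫ |u|³ ≤ 8 (∫ |u| |∇u|)^{3/2}`, where the left side is restricted to an octant. -/
lemma setLIntegral_octant_enorm_pow_three_le {r : ℝ} {u : E3 → E3}
    (hu : ContDiffOn ℝ 1 u (halfBall r))
    (hcont : ContinuousOn u {x | ‖x‖ < r ∧ 0 ≤ x 2})
    (hzero : ∀ x : E3, x 2 = 0 → ‖x‖ < r → u x = 0)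
    {a b : ℝ} (ha : a ^ 2 = 1) (hb : b ^ 2 = 1) :
    ∫⁻ x in halfBall r ∩ {x | 0 ≤ a * x 0 ∧ 0 ≤ b * x 1}, ‖u x‖ₑ ^ 3 ≤
      8 * (∫⁻ x in halfBall r, ‖u x‖ₑ * ‖fderiv ℝ u x‖ₑ) ^ ((3 : ℝ) / 2) := by
  have hopen := isOpen_halfBall r
  set h : E3 → ENNReal := (halfBall r).indicator fun x => ‖u x‖ₑ * ‖fderiv ℝ u x‖ₑ with hh
  have hmeas : Measurable h := by
    have h1 : Measurable ((halfBall r).indicator fun x => ‖u x‖ₑ) :=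
      hu.continuousOn.enorm.measurable_indicator_ennreal hopen.measurableSet
    have h2 : Measurable ((halfBall r).indicator fun x => ‖fderiv ℝ u x‖ₑ) :=
      (hu.continuousOn_fderiv_of_isOpen hopen le_rfl).enorm.measurable_indicator_ennreal
        hopen.measurableSet
    have : h = fun x => (halfBall r).indicator (fun x => ‖u x‖ₑ) x *
        (halfBall r).indicator (fun x => ‖fderiv ℝ u x‖ₑ) x := by
      funext x
      by_cases hx : x ∈ halfBall r <;> simp [hh, hx]
    rw [this]
    exact h1.mul h2
  set Q : Set E3 := halfBall r ∩ {x | 0 ≤ a * x 0 ∧ 0 ≤ b * x 1} with hQ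
  have hQm : MeasurableSet Q := by
    refine hopen.measurableSet.inter (IsClosed.measurableSet ?_)
    exact (isClosed_le continuous_const
        (continuous_const.mul (EuclideanSpace.proj (𝕜 := ℝ) (0 : Fin 3)).continuous)).inter
      (isClosed_le continuous_const
        (continuous_const.mul (EuclideanSpace.proj (𝕜 := ℝ) (1 : Fin 3)).continuous))
  have hline : ∀ x ∈ Q, ∀ i, ‖u x‖ₑ ^ 2 ≤ ∫⁻ s : ℝ, 4 * h (x + s • descentDir a b i) := by
    rintro x ⟨hx, hx0, hx1⟩ i
    have hcoord : ∀ s : ℝ, (x + s • descentDir a b i) 2 = x 2 - s := by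
      intro s; simp [descentDir_two, sub_eq_add_neg]
    have hnorm : ∀ s ∈ Icc 0 (x 2), ‖x + s • descentDir a b i‖ < r := fun s hs =>
      (norm_add_smul_descentDir_le ha hb i hx0 hx1 hs).trans_lt hx.1
    have hmem : ∀ s ∈ Ioo 0 (x 2), x + s • descentDir a b i ∈ halfBall r := fun s hs =>
      ⟨hnorm s ⟨hs.1.le, hs.2.le⟩, by rw [hcoord]; linarith [hs.2]⟩
    refine (enorm_sq_le_setLIntegral_segment hx.2.le (hcont.comp (by fun_prop) ?_) ?_ ?_
      (norm_descentDir_le ha hb i)).trans ?_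
    · exact fun s hs => ⟨hnorm s hs, by rw [hcoord]; linarith [hs.2]⟩
    · exact fun s hs =>
        (hu.differentiableOn one_ne_zero).differentiableAt (hopen.mem_nhds (hmem s hs))
    · exact hzero _ (by rw [hcoord, sub_self]) (hnorm _ ⟨hx.2.le, le_rfl⟩)
    · refine (setLIntegral_mono' measurableSet_Ioo fun s hs => ?_).trans
        (setLIntegral_le_lintegral (Ioo 0 (x 2)) _)
      rw [hh, indicator_of_mem (hmem s hs)]
  have hT := measurePreserving_descentMap ha hb
  have hFm : Measurable (Q.indicator fun x => ‖u x‖ₑ ^ 3) :=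
    (((ENNReal.continuous_pow 3).comp_continuousOn
      (hu.continuousOn.mono inter_subset_left).enorm)).measurable_indicator_ennreal hQm
  have hp : Real.HolderConjugate (Fintype.card (Fin 3)) ((3 : ℝ) / 2) := by
    rw [Real.holderConjugate_iff]; norm_num
  calc ∫⁻ x in Q, ‖u x‖ₑ ^ 3
      = ∫⁻ y, Q.indicator (fun x => ‖u x‖ₑ ^ 3) (descentMap a b y) := by
        rw [hT.lintegral_comp hFm, lintegral_indicator hQm]
    _ ≤ ∫⁻ y : Fin 3 → ℝ, ∏ i, (∫⁻ s : ℝ, 4 * h (descentMap a b (Function.update y i s))) ^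
          ((1 : ℝ) / ((Fintype.card (Fin 3) : ℝ) - 1)) := by
        refine lintegral_mono fun y => ?_
        by_cases hy : descentMap a b y ∈ Q
        swap
        · simp [hy]
        rw [indicator_of_mem hy]
        have hle : ∀ i, ‖u (descentMap a b y)‖ₑ ≤
            (∫⁻ s : ℝ, 4 * h (descentMap a b (Function.update y i s))) ^
              ((1 : ℝ) / ((Fintype.card (Fin 3) : ℝ) - 1)) := by
          intro i
          have h1 : ∫⁻ s : ℝ, 4 * h (descentMap a b (Function.update y i s)) =
              ∫⁻ s : ℝ, 4 * h (descentMap a b y + s • descentDir a b i) := by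
            simp_rw [descentMap_update]
            exact lintegral_sub_right_eq_self
              (fun s : ℝ => 4 * h (descentMap a b y + s • descentDir a b i)) (y i)
          rw [h1]
          calc ‖u (descentMap a b y)‖ₑ
              = (‖u (descentMap a b y)‖ₑ ^ 2) ^
                  ((1 : ℝ) / ((Fintype.card (Fin 3) : ℝ) - 1)) := by
                rw [← ENNReal.rpow_natCast, ← ENNReal.rpow_mul]; norm_num
            _ ≤ _ := ENNReal.rpow_le_rpow (hline _ hy i) (by norm_num)
        calc ‖u (descentMap a b y)‖ₑ ^ 3 = ∏ _i : Fin 3, ‖u (descentMap a b y)‖ₑ := by simp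
          _ ≤ _ := Finset.prod_le_prod' fun i _ => hle i
    _ ≤ (∫⁻ y, 4 * h (descentMap a b y)) ^ ((3 : ℝ) / 2) :=
        lintegral_prod_lintegral_pow_le (fun _ : Fin 3 => (volume : Measure ℝ)) hp
          (f := fun y => 4 * h (descentMap a b y))
          ((hmeas.comp hT.measurable).const_mul 4)
    _ = (4 * ∫⁻ x in halfBall r, ‖u x‖ₑ * ‖fderiv ℝ u x‖ₑ) ^ ((3 : ℝ) / 2) := by
        rw [hT.lintegral_comp (hmeas.const_mul 4), lintegral_const_mul _ hmeas,
          lintegral_indicator hopen.measurableSet]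
    _ = _ := by
        rw [ENNReal.mul_rpow_of_nonneg _ _ (by norm_num)]
        congr 1
        rw [show (4 : ENNReal) = 2 ^ (2 : ℝ) by norm_num, ← ENNReal.rpow_mul]
        norm_num

/-- A function on the half ball which vanishes on the flat boundary satisfies
`∫ |u|³ ≤ 32 (∫ |u|²)^{3/4} (∫ |∇u|²)^{3/4}`. -/
lemma setLIntegral_halfBall_enorm_pow_three_le {r : ℝ} {u : E3 → E3}
    (hu : ContDiffOn ℝ 1 u (halfBall r))
    (hcont : ContinuousOn u {x | ‖x‖ < r ∧ 0 ≤ x 2})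
    (hzero : ∀ x : E3, x 2 = 0 → ‖x‖ < r → u x = 0) :
    ∫⁻ x in halfBall r, ‖u x‖ₑ ^ 3 ≤
      32 * (∫⁻ x in halfBall r, ‖u x‖ₑ ^ 2) ^ ((3 : ℝ) / 4) *
        (∫⁻ x in halfBall r, ‖fderiv ℝ u x‖ₑ ^ 2) ^ ((3 : ℝ) / 4) := by
  have hopen := isOpen_halfBall r
  have hoct := fun {a b : ℝ} => setLIntegral_octant_enorm_pow_three_le hu hcont hzero (a := a)
    (b := b)
  set I := ∫⁻ x in halfBall r, ‖u x‖ₑ * ‖fderiv ℝ u x‖ₑ with hI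
  have hcover : halfBall r ⊆
      (halfBall r ∩ {x | 0 ≤ (1 : ℝ) * x 0 ∧ 0 ≤ (1 : ℝ) * x 1} ∪
        halfBall r ∩ {x | 0 ≤ (1 : ℝ) * x 0 ∧ 0 ≤ (-1 : ℝ) * x 1}) ∪
      (halfBall r ∩ {x | 0 ≤ (-1 : ℝ) * x 0 ∧ 0 ≤ (1 : ℝ) * x 1} ∪
        halfBall r ∩ {x | 0 ≤ (-1 : ℝ) * x 0 ∧ 0 ≤ (-1 : ℝ) * x 1}) := by
    intro x hx
    simp only [one_mul, neg_mul, Left.nonneg_neg_iff, mem_union, mem_inter_iff, hx, true_and,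
      Set.mem_ofPred_eq]
    rcases le_total 0 (x 0) with h0 | h0 <;> rcases le_total 0 (x 1) with h1 | h1 <;> tauto
  have hsum : ∫⁻ x in halfBall r, ‖u x‖ₑ ^ 3 ≤ 32 * I ^ ((3 : ℝ) / 2) := by
    calc ∫⁻ x in halfBall r, ‖u x‖ₑ ^ 3
        ≤ (8 * I ^ ((3 : ℝ) / 2) + 8 * I ^ ((3 : ℝ) / 2)) +
            (8 * I ^ ((3 : ℝ) / 2) + 8 * I ^ ((3 : ℝ) / 2)) := by
          refine (lintegral_mono_set hcover).trans ((lintegral_union_le _ _ _).trans (add_le_add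
            ((lintegral_union_le _ _ _).trans (add_le_add ?_ ?_))
            ((lintegral_union_le _ _ _).trans (add_le_add ?_ ?_)))) <;>
          exact hoct (by norm_num) (by norm_num)
      _ = 32 * I ^ ((3 : ℝ) / 2) := by ring
  have hCS : I ≤ (∫⁻ x in halfBall r, ‖u x‖ₑ ^ 2) ^ ((1 : ℝ) / 2) *
      (∫⁻ x in halfBall r, ‖fderiv ℝ u x‖ₑ ^ 2) ^ ((1 : ℝ) / 2) := by
    have := ENNReal.lintegral_mul_le_Lp_mul_Lq (volume.restrict (halfBall r))
      Real.HolderConjugate.two_two (f := fun x => ‖u x‖ₑ) (g := fun x => ‖fderiv ℝ u x‖ₑ)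
      (hu.continuousOn.aestronglyMeasurable hopen.measurableSet).enorm
      ((hu.continuousOn_fderiv_of_isOpen hopen le_rfl).aestronglyMeasurable
        hopen.measurableSet).enorm
    simpa [ENNReal.rpow_two] using this
  refine hsum.trans ?_
  rw [mul_assoc]
  gcongr
  refine (ENNReal.rpow_le_rpow hCS (by norm_num)).trans_eq ?_
  rw [ENNReal.mul_rpow_of_nonneg _ _ (by norm_num), ← ENNReal.rpow_mul, ← ENNReal.rpow_mul]
  norm_num

lemma measure_halfBall_ne_top (r : ℝ) : volume (halfBall r) ≠ ⊤ :=
  ((measure_mono fun _ hx => mem_ball_zero_iff.2 hx.1).trans_lt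
    (measure_ball_lt_top (x := (0 : E3)) (r := r))).ne

lemma integrableOn_halfBall_norm_pow {G : Type*} [NormedAddCommGroup G] {r M : ℝ} {f : E3 → G}
    (hf : ContinuousOn f (halfBall r)) (hM : ∀ x ∈ halfBall r, ‖f x‖ ≤ M) (n : ℕ) :
    IntegrableOn (fun x => ‖f x‖ ^ n) (halfBall r) := by
  have hm := (isOpen_halfBall r).measurableSet
  refine IntegrableOn.of_bound (measure_halfBall_ne_top r).lt_top
    ((hf.norm.pow n).aestronglyMeasurable hm) (M ^ n) ?_
  filter_upwards [ae_restrict_mem hm] with x hx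
  rw [norm_pow, norm_norm]
  exact pow_le_pow_left₀ (norm_nonneg _) (hM x hx) n

lemma setLIntegral_halfBall_enorm_pow {G : Type*} [NormedAddCommGroup G] {r M : ℝ} {f : E3 → G}
    (hf : ContinuousOn f (halfBall r)) (hM : ∀ x ∈ halfBall r, ‖f x‖ ≤ M) (n : ℕ) :
    ∫⁻ x in halfBall r, ‖f x‖ₑ ^ n = ENNReal.ofReal (∫ x in halfBall r, ‖f x‖ ^ n) := by
  rw [ofReal_integral_eq_lintegral_ofReal (integrableOn_halfBall_norm_pow hf hM n)
    (Filter.Eventually.of_forall fun x => by positivity)]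
  simp_rw [ENNReal.ofReal_pow (norm_nonneg _), ofReal_norm]

/-- The Gagliardo–Nirenberg type inequality `∫ |u|³ ≤ 32 (∫ |u|²)^{3/4} (∫ |∇u|²)^{3/4}` on the half
ball, for functions vanishing on the flat boundary. -/
lemma integral_halfBall_norm_pow_three_le {r M : ℝ} {u : E3 → E3}
    (hu : ContDiffOn ℝ 1 u (halfBall r))
    (hcont : ContinuousOn u {x | ‖x‖ < r ∧ 0 ≤ x 2})
    (hzero : ∀ x : E3, x 2 = 0 → ‖x‖ < r → u x = 0)
    (hM : ∀ x ∈ halfBall r, ‖u x‖ ≤ M) (hM' : ∀ x ∈ halfBall r, ‖fderiv ℝ u x‖ ≤ M) :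
    ∫ x in halfBall r, ‖u x‖ ^ 3 ≤
      32 * (∫ x in halfBall r, ‖u x‖ ^ 2) ^ ((3 : ℝ) / 4) *
        (∫ x in halfBall r, ‖fderiv ℝ u x‖ ^ 2) ^ ((3 : ℝ) / 4) := by
  have h := setLIntegral_halfBall_enorm_pow_three_le hu hcont hzero
  have hf' := hu.continuousOn_fderiv_of_isOpen (isOpen_halfBall r) le_rfl
  have h2 : 0 ≤ ∫ x in halfBall r, ‖u x‖ ^ 2 := integral_nonneg fun x => by positivity
  have h2' : 0 ≤ ∫ x in halfBall r, ‖fderiv ℝ u x‖ ^ 2 := integral_nonneg fun x => by positivity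
  rw [setLIntegral_halfBall_enorm_pow hu.continuousOn hM,
    setLIntegral_halfBall_enorm_pow hu.continuousOn hM,
    setLIntegral_halfBall_enorm_pow hf' hM',
    ENNReal.ofReal_rpow_of_nonneg h2 (by norm_num),
    ENNReal.ofReal_rpow_of_nonneg h2' (by norm_num),
    ← ENNReal.ofReal_ofNat 32, ← ENNReal.ofReal_mul (by norm_num),
    ← ENNReal.ofReal_mul (by positivity), ENNReal.ofReal_le_ofReal_iff (by positivity)] at h
  exact h

lemma mem_closure_halfBall {r : ℝ} {x : E3} (hx : ‖x‖ < r) (hx2 : 0 ≤ x 2) :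
    x ∈ closure (halfBall r) := by
  have hlim : Filter.Tendsto (fun s : ℝ => x + s • EuclideanSpace.single (2 : Fin 3) (1 : ℝ))
      (nhdsWithin 0 (Ioi 0)) (nhds x) := by
    have : Continuous fun s : ℝ => x + s • EuclideanSpace.single (2 : Fin 3) (1 : ℝ) := by
      fun_prop
    simpa using (this.tendsto 0).mono_left nhdsWithin_le_nhds
  refine mem_closure_of_tendsto hlim ?_
  filter_upwards [self_mem_nhdsWithin,
    hlim.eventually ((isOpen_lt continuous_norm continuous_const).mem_nhds hx)] with s hs hs'
  refine ⟨hs', ?_⟩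
  have : (0 : ℝ) < s := hs
  simp only [PiLp.add_apply, PiLp.smul_apply, PiLp.single_apply, if_true, smul_eq_mul]
  linarith

lemma isOpen_halfCyl (r : ℝ) : IsOpen (halfCyl r) := (isOpen_halfBall r).prod isOpen_Ioo

lemma isCompact_closure_halfCyl (r : ℝ) : IsCompact (closure (halfCyl r)) := by
  refine Bornology.IsBounded.isCompact_closure ?_
  refine Bornology.IsBounded.prod ?_ (Metric.isBounded_Ioo _ _)
  exact Metric.isBounded_ball.subset fun x hx => mem_ball_zero_iff.2 hx.1

lemma halfCyl_nonempty {r : ℝ} (hr : 0 < r) : (halfCyl r).Nonempty := by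
  refine ⟨(EuclideanSpace.single (2 : Fin 3) (r / 2), -r ^ 2 / 2), ⟨?_, ?_⟩, ?_, ?_⟩
  · simp [abs_of_pos hr]; linarith
  · simp [hr]
  · simp only; nlinarith [sq_pos_of_pos hr]
  · simp only; nlinarith [sq_pos_of_pos hr]

lemma uniqueDiffOn_closure_halfCyl {r : ℝ} (hr : 0 < r) :
    UniqueDiffOn ℝ (closure (halfCyl r)) := by
  have hconv : Convex ℝ (halfCyl r) := (convex_halfBall r).prod (convex_Ioo _ _)
  have hsub : halfCyl r ⊆ interior (closure (halfCyl r)) :=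
    (isOpen_halfCyl r).subset_interior_iff.2 subset_closure
  exact uniqueDiffOn_convex hconv.closure ((halfCyl_nonempty hr).mono hsub)

lemma fderiv_slice_eq {v : E3 → ℝ → E3} {x : E3} {t : ℝ}
    (h : DifferentiableAt ℝ (fun p : E3 × ℝ => v p.1 p.2) (x, t)) :
    fderiv ℝ (fun y => v y t) x =
      (fderiv ℝ (fun p : E3 × ℝ => v p.1 p.2) (x, t)).comp (ContinuousLinearMap.inl ℝ E3 ℝ) :=
  HasFDerivAt.fderiv (HasFDerivAt.comp x (g := fun p : E3 × ℝ => v p.1 p.2) (f := fun y => (y, t))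
    h.hasFDerivAt (hasFDerivAt_prodMk_left x t))

lemma exists_bound_slice {r : ℝ} (hr : 0 < r) {v : E3 → ℝ → E3}
    (hv : ContDiffOn ℝ 1 (fun p : E3 × ℝ => v p.1 p.2) (closure (halfCyl r))) :
    ∃ M : ℝ, ∀ x ∈ halfBall r, ∀ t ∈ Ioo (-r ^ 2) 0,
      ‖v x t‖ ≤ M ∧ ‖fderiv ℝ (fun y => v y t) x‖ ≤ M := by
  have hK := isCompact_closure_halfCyl r
  obtain ⟨M₀, h₀⟩ := hK.exists_bound_of_continuousOn hv.continuousOn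
  obtain ⟨M₁, h₁⟩ := hK.exists_bound_of_continuousOn
    (hv.continuousOn_fderivWithin (uniqueDiffOn_closure_halfCyl hr) le_rfl)
  refine ⟨max M₀ M₁, fun x hx t ht => ?_⟩
  have hmem : (x, t) ∈ halfCyl r := ⟨hx, ht⟩
  have hnhds : closure (halfCyl r) ∈ nhds (x, t) :=
    Filter.mem_of_superset ((isOpen_halfCyl r).mem_nhds hmem) subset_closure
  refine ⟨(h₀ (x, t) (subset_closure hmem)).trans (le_max_left _ _), ?_⟩
  rw [fderiv_slice_eq ((hv.differentiableOn one_ne_zero).differentiableAt hnhds),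
    ← fderivWithin_of_mem_nhds hnhds]
  refine (ContinuousLinearMap.opNorm_comp_le _ _).trans ?_
  refine (mul_le_of_le_one_right (norm_nonneg _) (ContinuousLinearMap.norm_inl_le_one ℝ E3 ℝ)).trans
    ((h₁ (x, t) (subset_closure hmem)).trans (le_max_right _ _))

lemma continuousOn_fderiv_slice {r : ℝ} {v : E3 → ℝ → E3}
    (hv : ContDiffOn ℝ 1 (fun p : E3 × ℝ => v p.1 p.2) (halfCyl r)) :
    ContinuousOn (fun p : E3 × ℝ => fderiv ℝ (fun y => v y p.2) p.1) (halfCyl r) := by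
  have hopen := isOpen_halfCyl r
  refine ((hv.continuousOn_fderiv_of_isOpen hopen le_rfl).clm_comp
    (continuousOn_const (c := ContinuousLinearMap.inl ℝ E3 ℝ))).congr fun p hp => ?_
  exact fderiv_slice_eq ((hv.differentiableOn one_ne_zero).differentiableAt (hopen.mem_nhds hp))

lemma integrableOn_integral_fderiv_slice {r M : ℝ} {v : E3 → ℝ → E3}
    (hv : ContDiffOn ℝ 1 (fun p : E3 × ℝ => v p.1 p.2) (halfCyl r))
    (hM : ∀ x ∈ halfBall r, ∀ t ∈ Ioo (-r ^ 2) (0 : ℝ), ‖fderiv ℝ (fun y => v y t) x‖ ≤ M) :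
    IntegrableOn (fun t => ∫ x in halfBall r, ‖fderiv ℝ (fun y => v y t) x‖ ^ 2)
      (Ioo (-r ^ 2) 0) := by
  have hm : MeasurableSet (halfCyl r) := (isOpen_halfCyl r).measurableSet
  have hint : IntegrableOn (fun p : E3 × ℝ => ‖fderiv ℝ (fun y => v y p.2) p.1‖ ^ 2)
      (halfCyl r) := by
    refine IntegrableOn.of_bound ?_
      (((continuousOn_fderiv_slice hv).norm.pow 2).aestronglyMeasurable hm) (M ^ 2) ?_
    · exact (measure_mono subset_closure).trans_lt (isCompact_closure_halfCyl r).measure_lt_top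
    · filter_upwards [ae_restrict_mem hm] with p hp
      rw [norm_pow, norm_norm]
      exact pow_le_pow_left₀ (norm_nonneg _) (hM p.1 hp.1 p.2 hp.2) 2
  rw [IntegrableOn, halfCyl, Measure.volume_eq_prod, ← Measure.prod_restrict] at hint
  exact hint.integral_prod_right

/-- Hölder's inequality on a set of finite measure, for the exponent `3/4`. -/
lemma integral_rpow_three_quarters_le {s : Set ℝ} (hs : volume s ≠ ⊤) {e : ℝ → ℝ}
    (he : ∀ t, 0 ≤ e t) (hint : IntegrableOn e s) :
    IntegrableOn (fun t => e t ^ ((3 : ℝ) / 4)) s ∧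
      ∫ t in s, e t ^ ((3 : ℝ) / 4) ≤
        (∫ t in s, e t) ^ ((3 : ℝ) / 4) * volume.real s ^ ((1 : ℝ) / 4) := by
  have : IsFiniteMeasure (volume.restrict s) := ⟨by simpa using hs.lt_top⟩
  have hp : Real.HolderConjugate ((4 : ℝ) / 3) 4 := by
    rw [Real.holderConjugate_iff]; norm_num
  have hpow : ∀ t, (e t ^ ((3 : ℝ) / 4)) ^ ((4 : ℝ) / 3) = e t := fun t => by
    rw [← Real.rpow_mul (he t)]; norm_num
  have hmem : MemLp (fun t => e t ^ ((3 : ℝ) / 4)) (ENNReal.ofReal (4 / 3))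
      (volume.restrict s) := by
    rw [← integrable_norm_rpow_iff _ (by norm_num) (by simp)]
    · simp_rw [Real.norm_of_nonneg (Real.rpow_nonneg (he _) _), ENNReal.toReal_ofReal
        (show (0 : ℝ) ≤ 4 / 3 by norm_num), hpow]
      exact hint
    · exact (hint.aestronglyMeasurable.aemeasurable.pow_const _).aestronglyMeasurable
  refine ⟨hmem.integrable (ENNReal.one_le_ofReal.2 (by norm_num)), ?_⟩
  have := integral_mul_le_Lp_mul_Lq_of_nonneg hp
    (Filter.Eventually.of_forall fun t => Real.rpow_nonneg (he t) _)
    (Filter.Eventually.of_forall fun _ => zero_le_one) hmem (memLp_const (1 : ℝ))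
  simpa [hpow] using this

/-- the multiplicative inequality
`C(v,r) ≤ c A(v,r)^{3/4} E(v,r)^{3/4}` with an absolute constant `c > 0`, for
vector fields vanishing on the flat part of the boundary. -/
theorem multiplicative_inequality :
    ∃ c : ℝ, 0 < c ∧ ∀ (r : ℝ), 0 < r → ∀ (v : E3 → ℝ → E3),
      ContDiffOn ℝ 1 (fun p : E3 × ℝ => v p.1 p.2) (closure (halfCyl r)) →
      (∀ x : E3, x 2 = 0 → ‖x‖ < r → ∀ t ∈ Ioo (-r^2) (0:ℝ), v x t = 0) →
      qtyC v r ≤ c * qtyA v r ^ ((3:ℝ)/4) * qtyE v r ^ ((3:ℝ)/4) := by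
  refine ⟨32, by norm_num, fun r hr v hv hzero => ?_⟩
  obtain ⟨M, hM⟩ := exists_bound_slice hr hv
  have hvo : ContDiffOn ℝ 1 (fun p : E3 × ℝ => v p.1 p.2) (halfCyl r) := hv.mono subset_closure
  set a : ℝ → ℝ := fun t => ∫ x in halfBall r, ‖v x t‖ ^ 2 with ha
  set e : ℝ → ℝ := fun t => ∫ x in halfBall r, ‖fderiv ℝ (fun y => v y t) x‖ ^ 2 with he
  have ha0 : ∀ t, 0 ≤ a t := fun t => integral_nonneg fun x => by positivity
  have he0 : ∀ t, 0 ≤ e t := fun t => integral_nonneg fun x => by positivity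
  have hslice : ∀ t ∈ Ioo (-r ^ 2) (0 : ℝ), ContDiffOn ℝ 1 (fun x => v x t) (halfBall r) :=
    fun t ht => hvo.comp (contDiff_prodMk_left t).contDiffOn fun x hx => ⟨hx, ht⟩
  have hsliceCont : ∀ t ∈ Ioo (-r ^ 2) (0 : ℝ),
      ContinuousOn (fun x => v x t) {x | ‖x‖ < r ∧ 0 ≤ x 2} := by
    refine fun t ht => hv.continuousOn.comp (by fun_prop : Continuous fun x : E3 =>
      (x, t)).continuousOn fun x hx => ?_
    rw [halfCyl, closure_prod_eq]
    exact ⟨mem_closure_halfBall hx.1 hx.2, subset_closure ht⟩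
  have hineq : ∀ t ∈ Ioo (-r ^ 2) (0 : ℝ), ∫ x in halfBall r, ‖v x t‖ ^ 3 ≤
      32 * a t ^ ((3 : ℝ) / 4) * e t ^ ((3 : ℝ) / 4) := fun t ht =>
    integral_halfBall_norm_pow_three_le (hslice t ht) (hsliceCont t ht)
      (fun x hx hxr => hzero x hx hxr t ht) (fun x hx => (hM x hx t ht).1)
      (fun x hx => (hM x hx t ht).2)
  have hbdd : BddAbove (range fun t : Ioo (-r ^ 2) (0 : ℝ) => (1 / r) * a t) := by
    refine ⟨(1 / r) * (M ^ 2 * volume.real (halfBall r)), ?_⟩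
    rintro _ ⟨t, rfl⟩
    have hconst := setIntegral_mono_on
      (integrableOn_halfBall_norm_pow (hslice t t.2).continuousOn (fun x hx => (hM x hx t t.2).1) 2)
      (integrableOn_const (C := M ^ 2) (measure_halfBall_ne_top r))
      (isOpen_halfBall r).measurableSet
      fun x hx => pow_le_pow_left₀ (norm_nonneg _) (hM x hx t t.2).1 2
    rw [setIntegral_const, smul_eq_mul, mul_comm] at hconst
    exact mul_le_mul_of_nonneg_left hconst (by positivity)
  have haA : ∀ t ∈ Ioo (-r ^ 2) (0 : ℝ), a t ≤ r * qtyA v r := by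
    intro t ht
    have h : (1 / r) * a t ≤ qtyA v r := le_ciSup hbdd ⟨t, ht⟩
    rw [one_div, inv_mul_le_iff₀ hr] at h
    exact h
  have hA0 : 0 ≤ qtyA v r := Real.iSup_nonneg fun t => mul_nonneg (by positivity) (ha0 t)
  obtain ⟨hei, hHolder⟩ := integral_rpow_three_quarters_le (s := Ioo (-r ^ 2) 0) (by simp) he0
    (integrableOn_integral_fderiv_slice hvo fun x hx t ht => (hM x hx t ht).2)
  have hE : ∫ t in Ioo (-r ^ 2) 0, e t = r * qtyE v r := by
    rw [qtyE]; field_simp; rfl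
  have hE0 : 0 ≤ qtyE v r :=
    mul_nonneg (by positivity) (integral_nonneg fun t => he0 t)
  have hvol : volume.real (Ioo (-r ^ 2) (0 : ℝ)) = r ^ 2 := by
    simp [Measure.real, sq_nonneg]
  rw [hE, hvol] at hHolder
  have htime : ∫ t in Ioo (-r ^ 2) 0, ∫ x in halfBall r, ‖v x t‖ ^ 3 ≤
      ∫ t in Ioo (-r ^ 2) 0, 32 * (r * qtyA v r) ^ ((3 : ℝ) / 4) * e t ^ ((3 : ℝ) / 4) := by
    refine integral_mono_of_nonneg
      (Filter.Eventually.of_forall fun t => integral_nonneg fun x => by positivity)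
      (hei.const_mul _) ?_
    filter_upwards [ae_restrict_mem measurableSet_Ioo] with t ht
    refine (hineq t ht).trans ?_
    have := haA t ht
    have := ha0 t
    have := Real.rpow_nonneg (he0 t) ((3 : ℝ) / 4)
    gcongr
  rw [integral_const_mul] at htime
  have hpow : r ^ ((3 : ℝ) / 4) * r ^ ((3 : ℝ) / 4) * (r ^ 2) ^ ((1 : ℝ) / 4) = r ^ 2 := by
    rw [← Real.rpow_natCast, ← Real.rpow_mul hr.le, ← Real.rpow_add hr, ← Real.rpow_add hr]
    norm_num
  rw [qtyC, one_div, inv_mul_le_iff₀ (by positivity)]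
  calc ∫ t in Ioo (-r ^ 2) 0, ∫ x in halfBall r, ‖v x t‖ ^ 3
      ≤ 32 * (r * qtyA v r) ^ ((3 : ℝ) / 4) *
          ((r * qtyE v r) ^ ((3 : ℝ) / 4) * (r ^ 2) ^ ((1 : ℝ) / 4)) :=
        htime.trans (by gcongr)
    _ = (r ^ ((3 : ℝ) / 4) * r ^ ((3 : ℝ) / 4) * (r ^ 2) ^ ((1 : ℝ) / 4)) *
          (32 * qtyA v r ^ ((3 : ℝ) / 4) * qtyE v r ^ ((3 : ℝ) / 4)) := by
        rw [Real.mul_rpow hr.le hA0, Real.mul_rpow hr.le hE0]; ring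
    _ = r ^ 2 * (32 * qtyA v r ^ ((3 : ℝ) / 4) * qtyE v r ^ ((3 : ℝ) / 4)) := by rw [hpow]
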